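/- Let A be an abelian category with enough injectives, and let (W1, F1) and (W2, F2) be complete cotorsion pairs in A such that W1 and W2 are thick, W1 ∩ F1 and W2 ∩ F2 both equal the class of injective objects of A, and F2 ⊆ F1. Define W := {X | there exists a short exact sequence 0 → X → A → B → 0 with A ∈ F2 and B ∈ W1}. Then W is thick: it is closed under direct summands, and for every short exact sequence in A in which two of the three terms belong to W, the third term belongs to W as well. -/

import Mathlib

open CategoryTheory CategoryTheory.Limits CategoryTheory.Abelian

universe w v u

variable {C : Type u} [Category.{v} C] [Abelian C]

/-- `f : X ⟶ Y` and `g : Y ⟶ Z` form a short exact sequence `0 → X → Y → Z → 0`. -/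
def IsShortExactSeq {X Y Z : C} (f : X ⟶ Y) (g : Y ⟶ Z) : Prop :=
  ∃ zero : f ≫ g = 0, (ShortComplex.mk f g zero).ShortExact

/-- `(D, E)` is a cotorsion pair: each class is the `Ext¹`-orthogonal of the other. -/
def IsCotorsionPair [HasExt.{w} C] (D E : Set C) : Prop :=
  (∀ X : C, X ∈ D ↔ ∀ Y ∈ E, Subsingleton (Ext.{w} X Y 1)) ∧
  (∀ Y : C, Y ∈ E ↔ ∀ X ∈ D, Subsingleton (Ext.{w} X Y 1))

/-- `(D, E)` is a complete cotorsion pair. -/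
def IsCompleteCotorsionPair [HasExt.{w} C] (D E : Set C) : Prop :=
  IsCotorsionPair.{w} D E ∧
  (∀ Z : C, ∃ (X Y : C) (f : Y ⟶ X) (g : X ⟶ Z), IsShortExactSeq f g ∧ X ∈ D ∧ Y ∈ E) ∧
  (∀ Z : C, ∃ (Y X : C) (f : Z ⟶ Y) (g : Y ⟶ X), IsShortExactSeq f g ∧ Y ∈ E ∧ X ∈ D)

/-- A class of objects is thick: closed under direct summands and satisfying the
2-out-of-3 property for short exact sequences. -/
def IsThickClass (W : Set C) : Prop :=
  (∀ X Y : C, X ∈ W → (∃ (i : Y ⟶ X) (r : X ⟶ Y), i ≫ r = 𝟙 Y) → Y ∈ W) ∧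
  (∀ ⦃X Y Z : C⦄ (f : X ⟶ Y) (g : Y ⟶ Z), IsShortExactSeq f g →
    ((X ∈ W ∧ Y ∈ W) ∨ (X ∈ W ∧ Z ∈ W) ∨ (Y ∈ W ∧ Z ∈ W)) → (X ∈ W ∧ Y ∈ W ∧ Z ∈ W))


section Aux

/-- Build a short exact sequence from a cokernel property. -/
lemma aux_mk {X Y Z : C} (f : X ⟶ Y) (g : Y ⟶ Z) [Mono f] [Epi g] (zero : f ≫ g = 0)
    (h : ∀ {A : C} (k : Y ⟶ A), f ≫ k = 0 → ∃ l : Z ⟶ A, g ≫ l = k) :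
    IsShortExactSeq f g := by
  refine ⟨zero, ?_⟩
  refine { exact := ?_, mono_f := ?_, epi_g := ?_ }
  · apply ShortComplex.exact_of_g_is_cokernel
    exact CokernelCofork.IsColimit.ofπ' g zero
      (fun k hk => ⟨(h k hk).choose, (h k hk).choose_spec⟩)
  · assumption
  · assumption

lemma aux_mono {X Y Z : C} {f : X ⟶ Y} {g : Y ⟶ Z} (h : IsShortExactSeq f g) : Mono f :=
  h.2.mono_f

lemma aux_epi {X Y Z : C} {f : X ⟶ Y} {g : Y ⟶ Z} (h : IsShortExactSeq f g) : Epi g :=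
  h.2.epi_g

lemma aux_desc {X Y Z A : C} {f : X ⟶ Y} {g : Y ⟶ Z} (h : IsShortExactSeq f g)
    (k : Y ⟶ A) (hk : f ≫ k = 0) : ∃ l : Z ⟶ A, g ≫ l = k := by
  obtain ⟨z, h⟩ := h
  have := h.epi_g
  exact ⟨h.exact.desc k hk, h.exact.g_desc k hk⟩

lemma aux_cokernel {X Y : C} (f : X ⟶ Y) [Mono f] : IsShortExactSeq f (cokernel.π f) :=
  aux_mk f _ (cokernel.condition f) (fun k hk => ⟨cokernel.desc f k hk, by simp⟩)

lemma aux_kernel {X Y : C} (f : X ⟶ Y) [Epi f] : IsShortExactSeq (kernel.ι f) f :=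
  ⟨kernel.condition f,
    { exact := ShortComplex.exact_of_f_is_kernel _ (kernelIsKernel f)
      mono_f := inferInstanceAs (Mono (kernel.ι f))
      epi_g := inferInstanceAs (Epi f) }⟩

/-- Pushout of a short exact sequence. -/
lemma aux_pushout {B D E A : C} {f : B ⟶ D} {g : D ⟶ E} (h : IsShortExactSeq f g) (c : B ⟶ A) :
    ∃ e : pushout c f ⟶ E, IsShortExactSeq (pushout.inl c f) e ∧ pushout.inr c f ≫ e = g := by
  have := aux_mono h
  have := aux_epi h
  have hz : f ≫ g = 0 := h.1
  have hw : c ≫ (0 : A ⟶ E) = f ≫ g := by simp [hz]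
  have e1 : pushout.inl c f ≫ pushout.desc 0 g hw = 0 := pushout.inl_desc _ _ _
  have e2 : pushout.inr c f ≫ pushout.desc 0 g hw = g := pushout.inr_desc _ _ _
  refine ⟨pushout.desc 0 g hw, ?_, e2⟩
  have : Epi (pushout.desc 0 g hw) := epi_of_epi_fac e2
  refine aux_mk _ _ e1 (fun k hk => ?_)
  obtain ⟨l, hl⟩ := aux_desc h (pushout.inr c f ≫ k) (by
    rw [← pushout.condition_assoc, hk, comp_zero])
  refine ⟨l, ?_⟩
  apply pushout.hom_ext
  · rw [hk, reassoc_of% e1, zero_comp]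
  · rw [reassoc_of% e2, hl]

/-- Third isomorphism theorem. -/
lemma aux_noether {X B Q D E : C} {f : X ⟶ B} {p : B ⟶ Q} {h : B ⟶ D} {g : D ⟶ E}
    (h1 : IsShortExactSeq f p) (h2 : IsShortExactSeq h g) :
    ∃ (G : C) (q : D ⟶ G) (a : Q ⟶ G) (b : G ⟶ E),
      IsShortExactSeq (f ≫ h) q ∧ IsShortExactSeq a b := by
  have := aux_mono h1
  have := aux_epi h1
  have := aux_mono h2
  obtain ⟨e, he, -⟩ := aux_pushout h2 p
  refine ⟨pushout p h, pushout.inr p h, pushout.inl p h, e, ?_, he⟩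
  have hz : f ≫ p = 0 := h1.1
  have : Epi (pushout.inr p h) := inferInstance
  refine aux_mk _ _ ?_ (fun k hk => ?_)
  · rw [Category.assoc, ← pushout.condition, reassoc_of% hz, zero_comp]
  · obtain ⟨l, hl⟩ := aux_desc h1 (h ≫ k) (by simpa using hk)
    exact ⟨pushout.desc l k hl, pushout.inr_desc _ _ _⟩

variable [HasExt.{w} C]

lemma aux_extend {X Y Z A : C} {f : X ⟶ Y} {g : Y ⟶ Z} (h : IsShortExactSeq f g)
    (hA : Subsingleton (Ext.{w} Z A 1)) (k : X ⟶ A) : ∃ l : Y ⟶ A, f ≫ l = k := by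
  obtain ⟨z, h⟩ := h
  obtain ⟨x, hx⟩ := Ext.contravariant_sequence_exact₁ h A (Ext.mk₀ k) (add_zero 1)
    (Subsingleton.elim _ _)
  obtain ⟨l, rfl⟩ := (Ext.mk₀_bijective _ _).2 x
  exact ⟨l, (Ext.mk₀_bijective _ _).1 (by simpa using hx)⟩

lemma aux_lift {X Y Z A : C} {f : X ⟶ Y} {g : Y ⟶ Z} (h : IsShortExactSeq f g)
    (hA : Subsingleton (Ext.{w} A X 1)) (k : A ⟶ Z) : ∃ l : A ⟶ Y, l ≫ g = k := by
  obtain ⟨z, h⟩ := h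
  obtain ⟨x, hx⟩ := Ext.covariant_sequence_exact₃ A h (Ext.mk₀ k) (zero_add 1)
    (Subsingleton.elim _ _)
  obtain ⟨l, rfl⟩ := (Ext.mk₀_bijective _ _).2 x
  exact ⟨l, (Ext.mk₀_bijective _ _).1 (by simpa using hx)⟩

lemma aux_sub {X Y : C} {n : ℕ} (h : ∀ e : Ext.{w} X Y n, e = 0) : Subsingleton (Ext.{w} X Y n) :=
  ⟨fun a b => by rw [h a, h b]⟩

lemma aux_ext_mid {X Y Z A : C} {f : X ⟶ Y} {g : Y ⟶ Z} (h : IsShortExactSeq f g)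
    (hX : Subsingleton (Ext.{w} A X 1)) (hZ : Subsingleton (Ext.{w} A Z 1)) :
    Subsingleton (Ext.{w} A Y 1) := by
  obtain ⟨z, h⟩ := h
  refine aux_sub (fun e => ?_)
  obtain ⟨x, hx⟩ := Ext.covariant_sequence_exact₂ A h e (Subsingleton.elim _ _)
  rw [← hx, Subsingleton.elim x 0, Ext.zero_comp]

lemma aux_ext_retract {X Y A : C} (i : Y ⟶ X) (r : X ⟶ Y) (hir : i ≫ r = 𝟙 Y)
    (hX : Subsingleton (Ext.{w} A X 1)) : Subsingleton (Ext.{w} A Y 1) := by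
  refine aux_sub (fun e => ?_)
  have : (e.comp (Ext.mk₀ i) (add_zero 1)).comp (Ext.mk₀ r) (add_zero 1) = e := by simp [hir]
  rw [← this, Subsingleton.elim (e.comp (Ext.mk₀ i) (add_zero 1)) 0, Ext.zero_comp]

/-- `Ext¹` is effaceable in the first variable. -/
lemma aux_efface [EnoughInjectives C] {D X : C} (e : Ext.{w} D X 1) :
    ∃ (E : C) (p : E ⟶ D), Epi p ∧ (Ext.mk₀ p).comp e (zero_add 1) = 0 := by
  obtain ⟨z, h⟩ := aux_cokernel (Injective.ι X)
  obtain ⟨x, hx⟩ := Ext.covariant_sequence_exact₁ D h e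
    (Ext.eq_zero_of_injective (n := 0) _) (zero_add 1)
  obtain ⟨k, rfl⟩ := (Ext.mk₀_bijective _ _).2 x
  refine ⟨pullback (cokernel.π (Injective.ι X)) k, pullback.snd _ _, inferInstance, ?_⟩
  rw [← hx, Ext.mk₀_comp_mk₀_assoc]
  have hc : pullback.snd (cokernel.π (Injective.ι X)) k ≫ k =
    pullback.fst (cokernel.π (Injective.ι X)) k ≫ cokernel.π (Injective.ι X) :=
      pullback.condition.symm
  erw [hc]
  rw [← Ext.mk₀_comp_mk₀_assoc]
  erw [h.comp_extClass]
  rw [Ext.comp_zero]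

/-- The right class of a hereditary complete cotorsion pair is closed under cokernels of monos. -/
lemma aux_hereditary [EnoughInjectives C] {D E : Set C} (hp : IsCompleteCotorsionPair.{w} D E)
    (ht : IsThickClass D) {X Y Z : C} {f : X ⟶ Y} {g : Y ⟶ Z} (h : IsShortExactSeq f g)
    (hX : X ∈ E) (hY : Y ∈ E) : Z ∈ E := by
  rw [hp.1.2] at hX hY ⊢
  intro d hd
  refine aux_sub (fun e => ?_)
  obtain ⟨T, p, hp1, hp2⟩ := aux_efface e
  obtain ⟨V, K, k, q, hq, hV, -⟩ := hp.2.1 T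
  have := aux_epi hq
  have hs := aux_kernel (q ≫ p)
  have hV' : kernel (q ≫ p) ∈ D := (ht.2 _ _ hs (Or.inr (Or.inr ⟨hV, hd⟩))).1
  obtain ⟨z, hs⟩ := hs
  obtain ⟨x, hx⟩ := Ext.contravariant_sequence_exact₃ hs Z e
    (by
      change (Ext.mk₀ (q ≫ p)).comp e (zero_add 1) = 0
      rw [← Ext.mk₀_comp_mk₀_assoc, hp2, Ext.comp_zero]) (add_zero 1)
  obtain ⟨a, rfl⟩ := (Ext.mk₀_bijective _ _).2 x
  obtain ⟨b, rfl⟩ := aux_lift h (hX _ hV') a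
  have := hY d hd
  have h0 : hs.extClass.comp (Ext.mk₀ b) (add_zero 1) = 0 := Subsingleton.elim (α := Ext.{w} d Y 1) _ _
  rw [← hx, ← Ext.mk₀_comp_mk₀, ← Ext.comp_assoc_of_third_deg_zero, h0, Ext.zero_comp]

lemma aux_E_ext {D E : Set C} (hp : IsCotorsionPair.{w} D E)
    {X Y Z : C} {f : X ⟶ Y} {g : Y ⟶ Z} (h : IsShortExactSeq f g)
    (hX : X ∈ E) (hZ : Z ∈ E) : Y ∈ E := by
  rw [hp.2] at hX hZ ⊢
  exact fun d hd => aux_ext_mid h (hX d hd) (hZ d hd)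

lemma aux_E_retract {D E : Set C} (hp : IsCotorsionPair.{w} D E)
    {X Y : C} (i : Y ⟶ X) (r : X ⟶ Y) (hir : i ≫ r = 𝟙 Y) (hX : X ∈ E) : Y ∈ E := by
  rw [hp.2] at hX ⊢
  exact fun d hd => aux_ext_retract i r hir (hX d hd)

lemma aux_biprod (X Y : C) :
    IsShortExactSeq (biprod.inl : X ⟶ X ⊞ Y) (biprod.snd : X ⊞ Y ⟶ Y) := by
  refine aux_mk _ _ (by simp) (fun k hk => ⟨biprod.inr ≫ k, ?_⟩)
  apply biprod.hom_ext'
  · simp [hk]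
  · simp

/-- Within `F₁`, the class `F₂` is closed under kernels of epimorphisms. -/
lemma aux_kernel_closed {W₁ F₁ W₂ F₂ : Set C}
    (hpair₁ : IsCompleteCotorsionPair.{w} W₁ F₁)
    (hpair₂ : IsCompleteCotorsionPair.{w} W₂ F₂)
    (hWF₁ : W₁ ∩ F₁ = {X : C | Injective X})
    (hWF₂ : W₂ ∩ F₂ = {X : C | Injective X})
    {X Y Z : C} {f : X ⟶ Y} {g : Y ⟶ Z} (h : IsShortExactSeq f g)
    (hX : X ∈ F₁) (hY : Y ∈ F₂) (hZ : Z ∈ F₂) : X ∈ F₂ := by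
  rw [hpair₂.1.2]
  intro d hd
  refine aux_sub (fun e => ?_)
  obtain ⟨V, K, k, q, hq, hV, hK⟩ := hpair₂.2.1 Z
  have hV2 : V ∈ F₂ := aux_E_ext hpair₂.1 hq hK hZ
  have hV1 : V ∈ W₁ ∩ F₁ := by
    rw [hWF₁, ← hWF₂]; exact ⟨hV, hV2⟩
  obtain ⟨z, h⟩ := h
  have := (hpair₂.1.2 Y).1 hY d hd
  obtain ⟨x, hx⟩ := Ext.covariant_sequence_exact₁ d h e
    (Subsingleton.elim (α := Ext.{w} d Y 1) _ _) (zero_add 1)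
  obtain ⟨a, rfl⟩ := (Ext.mk₀_bijective _ _).2 x
  obtain ⟨b, rfl⟩ := aux_lift hq ((hpair₂.1.2 K).1 hK d hd) a
  have := (hpair₁.1.2 X).1 hX V hV1.1
  have h0 : (Ext.mk₀ q).comp h.extClass (zero_add 1) = 0 :=
    Subsingleton.elim (α := Ext.{w} V X 1) _ _
  rw [← hx, ← Ext.mk₀_comp_mk₀_assoc, h0, Ext.comp_zero]

/-- Retracts have fibrant replacements that are retracts up to injectives. -/
lemma aux_unique [EnoughInjectives C] {W₁ F₁ W₂ F₂ : Set C}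
    (hpair₁ : IsCompleteCotorsionPair.{w} W₁ F₁)
    (hpair₂ : IsCompleteCotorsionPair.{w} W₂ F₂)
    (hthick₁ : IsThickClass W₁)
    (hWF₁ : W₁ ∩ F₁ = {X : C | Injective X})
    (hWF₂ : W₂ ∩ F₂ = {X : C | Injective X})
    (hsub : F₂ ⊆ F₁)
    {X Y A B R Q : C} {f : X ⟶ A} {g : A ⟶ B} {f' : Y ⟶ R} {g' : R ⟶ Q}
    (h : IsShortExactSeq f g) (hA : A ∈ F₂) (hB : B ∈ W₁)
    (h' : IsShortExactSeq f' g') (hR : R ∈ F₁) (hQ : Q ∈ W₁)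
    (i : Y ⟶ X) (r : X ⟶ Y) (hir : i ≫ r = 𝟙 Y) : R ∈ F₂ := by
  obtain ⟨φ, hφ⟩ := aux_extend h' ((hpair₁.1.2 A).1 (hsub hA) Q hQ) (i ≫ f)
  obtain ⟨ψ, hψ⟩ := aux_extend h ((hpair₁.1.2 R).1 hR B hB) (r ≫ f')
  obtain ⟨l, hl⟩ := aux_desc h' (𝟙 R - φ ≫ ψ) (by
    rw [Preadditive.comp_sub, reassoc_of% hφ, hψ, reassoc_of% hir, Category.comp_id, sub_self])
  have hJ := aux_cokernel (Injective.ι Q)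
  have hJi : Injective (Injective.under Q) := inferInstance
  have hJ1 : Injective.under Q ∈ W₁ ∩ F₁ := by rw [hWF₁]; exact hJi
  have hJ2 : Injective.under Q ∈ W₂ ∩ F₂ := by rw [hWF₂]; exact hJi
  have hc := (hthick₁.2 _ _ hJ (Or.inl ⟨hQ, hJ1.1⟩)).2.2
  obtain ⟨m, hm⟩ := aux_extend hJ ((hpair₁.1.2 R).1 hR _ hc) l
  have hS : (A ⊞ Injective.under Q : C) ∈ F₂ := aux_E_ext hpair₂.1 (aux_biprod _ _) hA hJ2.2
  refine aux_E_retract hpair₂.1 (biprod.lift φ (g' ≫ Injective.ι Q)) (biprod.desc ψ m) ?_ hS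
  rw [biprod.lift_desc, Category.assoc, hm, hl]
  abel

/-- Horseshoe construction. -/
lemma aux_horseshoe [EnoughInjectives C] {W₁ F₁ : Set C}
    (hpair₁ : IsCompleteCotorsionPair.{w} W₁ F₁) (hthick₁ : IsThickClass W₁)
    {X Y Z : C} {f : X ⟶ Y} {g : Y ⟶ Z} (h : IsShortExactSeq f g) :
    ∃ (R T S QX QY QZ : C) (fX : X ⟶ R) (gX : R ⟶ QX) (fY : Y ⟶ T) (gY : T ⟶ QY)
      (fZ : Z ⟶ S) (gZ : S ⟶ QZ) (a : R ⟶ T) (b : T ⟶ S),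
      IsShortExactSeq fX gX ∧ IsShortExactSeq fY gY ∧ IsShortExactSeq fZ gZ ∧
      IsShortExactSeq a b ∧ R ∈ F₁ ∧ T ∈ F₁ ∧ S ∈ F₁ ∧ QX ∈ W₁ ∧ QY ∈ W₁ ∧ QZ ∈ W₁ := by
  obtain ⟨R, QX, fX, gX, hX, hR, hQX⟩ := hpair₁.2.2 X
  obtain ⟨e, he, -⟩ := aux_pushout h fX
  obtain ⟨e', he', -⟩ := aux_pushout hX f
  let s := pushoutSymmetry f fX
  obtain ⟨T, QT, t, u, hT, hTF, hQT⟩ := hpair₁.2.2 (pushout fX f)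
  have he2 : IsShortExactSeq (pushout.inr fX f) (s.inv ≫ e') := by
    have := aux_mono hX
    have := aux_epi he'
    have hz : pushout.inl f fX ≫ e' = 0 := he'.1
    refine aux_mk _ _ (by simp [s, hz]) (fun k hk => ?_)
    obtain ⟨l, hl⟩ := aux_desc he' (s.hom ≫ k) (by simp [s, hk])
    exact ⟨l, by simp [hl]⟩
  obtain ⟨S, b, fZ, gZ, h1, h2⟩ := aux_noether he hT
  obtain ⟨QY, gY, m, n, h3, h4⟩ := aux_noether he2 hT
  exact ⟨R, T, S, QX, QY, QT, fX, gX, _, gY, fZ, gZ, _, b, hX, h3, h2, h1, hR, hTF,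
    aux_hereditary hpair₁ hthick₁ h1 hR hTF, hQX,
    (hthick₁.2 _ _ h4 (Or.inr (Or.inl ⟨hQX, hQT⟩))).2.1, hQT⟩

end Aux

/-- In the localization setup (complete cotorsion pairs `(W₁, F₁)`,
`(W₂, F₂)`, both `Wᵢ` thick, `Wᵢ ∩ Fᵢ` the injectives, `F₂ ⊆ F₁`), the class
`W := {X | ∃ SES 0 → X → A → B → 0, A ∈ F₂, B ∈ W₁}` is thick. -/
theorem stmt9 [EnoughInjectives C] [HasExt.{w} C] (W₁ F₁ W₂ F₂ : Set C)
    (hpair₁ : IsCompleteCotorsionPair.{w} W₁ F₁)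
    (hpair₂ : IsCompleteCotorsionPair.{w} W₂ F₂)
    (hthick₁ : IsThickClass W₁) (hthick₂ : IsThickClass W₂)
    (hWF₁ : W₁ ∩ F₁ = {X : C | Injective X})
    (hWF₂ : W₂ ∩ F₂ = {X : C | Injective X})
    (hsub : F₂ ⊆ F₁)
    (W : Set C)
    (hW : W = {X : C | ∃ (A B : C) (f : X ⟶ A) (g : A ⟶ B),
        IsShortExactSeq f g ∧ A ∈ F₂ ∧ B ∈ W₁}) :
    IsThickClass W := by
  have key : ∀ {X R Q : C} {f : X ⟶ R} {g : R ⟶ Q}, IsShortExactSeq f g → R ∈ F₁ → Q ∈ W₁ →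
      X ∈ W → R ∈ F₂ := by
    intro X R Q f g h hR hQ hX
    rw [hW] at hX
    obtain ⟨A, B, f', g', h', hA, hB⟩ := hX
    exact aux_unique hpair₁ hpair₂ hthick₁ hWF₁ hWF₂ hsub h' hA hB h hR hQ (𝟙 X) (𝟙 X) (by simp)
  have key' : ∀ {X R Q : C} {f : X ⟶ R} {g : R ⟶ Q}, IsShortExactSeq f g → Q ∈ W₁ →
      R ∈ F₂ → X ∈ W := by
    intro X R Q f g h hQ hR
    rw [hW]
    exact ⟨R, Q, f, g, h, hR, hQ⟩
  constructor
  · rintro X Y hX ⟨i, r, hir⟩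
    rw [hW] at hX
    obtain ⟨A, B, f, g, h, hA, hB⟩ := hX
    obtain ⟨R, Q, f', g', h', hR, hQ⟩ := hpair₁.2.2 Y
    exact key' h' hQ
      (aux_unique hpair₁ hpair₂ hthick₁ hWF₁ hWF₂ hsub h hA hB h' hR hQ i r hir)
  · intro X Y Z f g h hcases
    obtain ⟨R, T, S, QX, QY, QZ, fX, gX, fY, gY, fZ, gZ, a, b, hX, hY, hZ, hab, hR, hT, hS,
      hQX, hQY, hQZ⟩ := aux_horseshoe hpair₁ hthick₁ h
    rcases hcases with ⟨h1, h2⟩ | ⟨h1, h2⟩ | ⟨h1, h2⟩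
    · exact ⟨h1, h2, key' hZ hQZ
        (aux_hereditary hpair₂ hthick₂ hab (key hX hR hQX h1) (key hY hT hQY h2))⟩
    · exact ⟨h1, key' hY hQY
        (aux_E_ext hpair₂.1 hab (key hX hR hQX h1) (key hZ hS hQZ h2)), h2⟩
    · exact ⟨key' hX hQX (aux_kernel_closed hpair₁ hpair₂ hWF₁ hWF₂ hab hR
        (key hY hT hQY h1) (key hZ hS hQZ h2)), h1, h2⟩
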